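/- Let d, b, k, n ∈ ℕ and 0 < δ ≤ 1, and let W = (W_i)_{i=1}^∞ be a non-negative non-increasing sequence converging to 0 and L = (L_i)_{i=1}^∞ a non-negative non-decreasing sequence. There exists an estimator V_n, i.e., a measurable map from n-tuples of points in [0,1]^d to the set 𝒟_d of pdfs supported on [0,1]^d, such that for every density p ∈ 𝒟_d ∩ 𝔙(W, L), if X_1,…,X_n are i.i.d. with density p then P( ‖p − V_n(X_1,…,X_n)‖_1 > (√3 d / (2b)) L_k + 6 W_k + 7√(2bdk·log(4bdkn)/n) + 7√(log(3/δ)/(2n)) ) < δ. -/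

import Mathlib

open MeasureTheory Filter Finset

noncomputable section

/-- A pdf on `ℝ`: a Lebesgue-measurable, a.e. non-negative function with integral one. -/
def IsPdf1 (f : ℝ → ℝ) : Prop :=
  Measurable f ∧ (∀ᵐ x ∂(volume : Measure ℝ), 0 ≤ f x) ∧ ∫ x, f x = 1

/-- Membership in `𝒟_d`: a pdf on `ℝ^d` supported on the unit cube `[0,1]^d`. -/
def MemD (d : ℕ) (p : (Fin d → ℝ) → ℝ) : Prop :=
  Measurable p ∧ (∀ᵐ x ∂(volume : Measure (Fin d → ℝ)), 0 ≤ p x) ∧ (∫ x, p x = 1) ∧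
    ∀ x, x ∉ Set.Icc (0 : Fin d → ℝ) 1 → p x = 0

/-- `p` has NL-spectrum `(w, L)` (sequences `0`-indexed: index `i` is the paper's `i+1`). -/
def HasNLSpectrum (d : ℕ) (p : (Fin d → ℝ) → ℝ) (w L : ℕ → ℝ) : Prop :=
  ∃ q : ℕ → Fin d → ℝ → ℝ,
    (∀ i, 0 ≤ w i) ∧ 0 < w 0 ∧ HasSum w 1 ∧
    (∀ i j, IsPdf1 (q i j) ∧ ∀ x y, |q i j x - q i j y| ≤ L i * |x - y|) ∧
    ∀ᵐ x ∂(volume : Measure (Fin d → ℝ)), p x = ∑' i, w i * ∏ j, q i j (x j)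

/-- Membership in the NL-class `𝔙(W, L̃)` (all sequences `0`-indexed: index `i` is the
paper's `i+1`): `p` has an NL-spectrum `(w, L)` with `L_k ≤ L̃_k` and
`∑_{i=k+1}^∞ w_i ≤ W_k` for all (paper) `k ≥ 1`. -/
def MemNLClass (d : ℕ) (p : (Fin d → ℝ) → ℝ) (W Lt : ℕ → ℝ) : Prop :=
  ∃ w L : ℕ → ℝ, HasNLSpectrum d p w L ∧
    ∀ k : ℕ, L k ≤ Lt k ∧ (∑' i, w (i + (k + 1))) ≤ W k

def empM {d n : ℕ} (A : Set (Fin d → ℝ)) (xs : Fin n → Fin d → ℝ) : ℝ :=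
  (∑ i, A.indicator (fun _ => (1 : ℝ)) (xs i)) / n

theorem hoeff_one {E : Type*} [MeasurableSpace E] (n : ℕ) (hn : 1 ≤ n) (μ : Measure E)
    [IsProbabilityMeasure μ] (φ : E → ℝ) (hφ : Measurable φ) (a : ℝ)
    (h01 : ∀ x, φ x ∈ Set.Icc a (a + 1)) (t : ℝ) (ht : 0 ≤ t) :
    (Measure.pi (fun _ : Fin n => μ)).real {xs | t ≤ (∑ i, φ (xs i)) / n - ∫ x, φ x ∂μ}
      ≤ Real.exp (-2 * n * t ^ 2) := by
  have hn0 : (0 : ℝ) < n := by exact_mod_cast hn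
  have hind : ProbabilityTheory.iIndepFun
      (fun (i : Fin n) (xs : Fin n → E) => φ (xs i) - ∫ x, φ x ∂μ) (Measure.pi (fun _ : Fin n => μ)) :=
    ProbabilityTheory.iIndepFun_pi (X := fun _ x => φ x - ∫ x, φ x ∂μ)
      (fun i => (hφ.sub_const _).aemeasurable)
  have hsub : ∀ i ∈ (Finset.univ : Finset (Fin n)), ProbabilityTheory.HasSubgaussianMGF
      (fun (xs : Fin n → E) => φ (xs i) - ∫ x, φ x ∂μ) ((‖(a + 1) - a‖₊ / 2) ^ 2)
      (Measure.pi (fun _ : Fin n => μ)) := by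
    intro i _
    have h := ProbabilityTheory.hasSubgaussianMGF_of_mem_Icc (μ := Measure.pi (fun _ : Fin n => μ))
      (X := fun xs => φ (xs i)) (a := a) (b := a + 1)
      (hφ.comp (measurable_pi_apply i)).aemeasurable (Eventually.of_forall fun x => h01 _)
    have he : ∫ xs : Fin n → E, φ (xs i) ∂(Measure.pi (fun _ : Fin n => μ)) = ∫ x, φ x ∂μ := by
      exact integral_comp_eval (μ := fun _ : Fin n => μ) (i := i) hφ.aestronglyMeasurable
    rwa [he] at h
  have h := ProbabilityTheory.HasSubgaussianMGF.measure_sum_ge_le_of_iIndepFun hind hsub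
    (ε := n * t) (by positivity)
  have hset : {xs : Fin n → E | t ≤ (∑ i, φ (xs i)) / n - ∫ x, φ x ∂μ}
      = {xs | n * t ≤ ∑ i, (φ (xs i) - ∫ x, φ x ∂μ)} := by
    ext xs
    simp only [Set.mem_ofPred_eq, Finset.sum_sub_distrib, Finset.sum_const, Finset.card_univ,
      Fintype.card_fin, nsmul_eq_mul]
    rw [le_sub_iff_add_le, le_div_iff₀ hn0, le_sub_iff_add_le]
    constructor <;> intro h <;> linarith
  rw [hset]
  refine h.trans (le_of_eq ?_)
  congr 1
  simp
  field_simp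

theorem hoeff_two {d : ℕ} (n : ℕ) (hn : 1 ≤ n) (μ : Measure (Fin d → ℝ))
    [IsProbabilityMeasure μ] (A : Set (Fin d → ℝ)) (hA : MeasurableSet A) (t : ℝ) (ht : 0 ≤ t) :
    (Measure.pi (fun _ : Fin n => μ)) {xs | t ≤ |empM A xs - μ.real A|}
      ≤ ENNReal.ofReal (2 * Real.exp (-2 * n * t ^ 2)) := by
  have hm : Measurable (A.indicator (fun _ => (1 : ℝ))) := measurable_const.indicator hA
  have hIntg : ∫ x, A.indicator (fun _ => (1 : ℝ)) x ∂μ = μ.real A := by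
    rw [integral_indicator hA]; simp
  have h1 := hoeff_one n hn μ _ hm 0 (fun x => by
    by_cases hx : x ∈ A <;> simp [hx]) t ht
  have h2 := hoeff_one n hn μ _ hm.neg (-1) (fun x => by
    by_cases hx : x ∈ A <;> simp [hx]) t ht
  rw [← ofReal_measureReal]
  apply ENNReal.ofReal_le_ofReal
  have hsub : {xs : Fin n → Fin d → ℝ | t ≤ |empM A xs - μ.real A|} ⊆
      {xs | t ≤ (∑ i, A.indicator (fun _ => (1 : ℝ)) (xs i)) / n - ∫ x, A.indicator (fun _ => (1 : ℝ)) x ∂μ}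
      ∪ {xs | t ≤ (∑ i, (-A.indicator (fun _ => (1 : ℝ))) (xs i)) / n - ∫ x, (-A.indicator (fun _ => (1 : ℝ))) x ∂μ} := by
    intro xs hxs
    simp only [Set.mem_ofPred_eq, empM] at hxs
    simp only [Set.mem_union, Set.mem_ofPred_eq, Pi.neg_apply, Finset.sum_neg_distrib,
      integral_neg, hIntg]
    rcases le_abs.1 hxs with h | h
    · left; exact h
    · right; rw [neg_div]; linarith
  calc _ ≤ _ := measureReal_mono hsub
    _ ≤ _ := measureReal_union_le _ _
    _ ≤ _ := by linarith

theorem MemD.integrable {d : ℕ} {p : (Fin d → ℝ) → ℝ} (h : MemD d p) : Integrable p := by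
  by_contra hc
  have := h.2.2.1
  rw [integral_undef hc] at this
  norm_num at this

theorem l1_tri {E : Type*} [MeasurableSpace E] {μ : Measure E} {f g h : E → ℝ}
    (hf : Integrable f μ) (hg : Integrable g μ) (hh : Integrable h μ) :
    ∫ x, |f x - h x| ∂μ ≤ (∫ x, |f x - g x| ∂μ) + ∫ x, |g x - h x| ∂μ := by
  have h1 : Integrable (fun x => |f x - g x|) μ := (hf.sub hg).abs
  have h2 : Integrable (fun x => |g x - h x|) μ := (hg.sub hh).abs
  have h3 : Integrable (fun x => |f x - h x|) μ := (hf.sub hh).abs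
  rw [← integral_add h1 h2]
  exact integral_mono h3 (h1.add h2) fun x => abs_sub_le _ _ _

/-- Difference of masses on a set is at most half the L1 distance. -/
theorem half_l1 {d : ℕ} {p q : (Fin d → ℝ) → ℝ} (hp : MemD d p) (hq : MemD d q)
    (A : Set (Fin d → ℝ)) (hA : MeasurableSet A) :
    2 * |(∫ x in A, p x) - ∫ x in A, q x| ≤ ∫ x, |p x - q x| := by
  have hi := hp.integrable.sub hq.integrable
  have e1 := integral_add_compl hA hi
  have e2 := integral_add_compl hA hi.abs
  have e0 : ∫ x, (p - q) x = 0 := by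
    simp only [Pi.sub_apply]
    rw [integral_sub hp.integrable hq.integrable, hp.2.2.1, hq.2.2.1]; ring
  have e3 : ∫ x in A, (p - q) x = (∫ x in A, p x) - ∫ x in A, q x := 
    integral_sub hp.integrable.integrableOn hq.integrable.integrableOn
  have a1 : |∫ x in A, (p - q) x| ≤ ∫ x in A, |(p - q) x| := abs_integral_le_integral_abs
  have a2 : |∫ x in Aᶜ, (p - q) x| ≤ ∫ x in Aᶜ, |(p - q) x| := abs_integral_le_integral_abs
  rw [e0] at e1
  have e4 : ∫ x in Aᶜ, (p - q) x = - ∫ x in A, (p - q) x := by linarith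
  rw [e4, abs_neg] at a2
  rw [← e3]
  have e5 : ∫ x, |p x - q x| = ∫ x, |(p - q) x| := rfl
  rw [e5, ← e2]
  linarith

theorem scheffe {d : ℕ} {p q : (Fin d → ℝ) → ℝ} (hp : MemD d p) (hq : MemD d q) :
    ∫ x, |p x - q x| = 2 * ((∫ x in {x | q x < p x}, p x) - ∫ x in {x | q x < p x}, q x) := by
  have hA : MeasurableSet {x | q x < p x} := measurableSet_lt hq.1 hp.1
  have hi := hp.integrable.sub hq.integrable
  have e1 := integral_add_compl hA hi
  have e2 := integral_add_compl hA hi.abs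
  have e0 : ∫ x, (p - q) x = 0 := by
    simp only [Pi.sub_apply]
    rw [integral_sub hp.integrable hq.integrable, hp.2.2.1, hq.2.2.1]; ring
  have e3 : ∫ x in {x | q x < p x}, (p - q) x = (∫ x in {x | q x < p x}, p x) - ∫ x in {x | q x < p x}, q x := 
    integral_sub hp.integrable.integrableOn hq.integrable.integrableOn
  have b1 : ∫ x in {x | q x < p x}, |(p - q) x| = ∫ x in {x | q x < p x}, (p - q) x := by
    apply setIntegral_congr_fun hA
    intro x hx
    exact abs_of_pos (sub_pos.2 hx)
  have b2 : ∫ x in {x | q x < p x}ᶜ, |(p - q) x| = ∫ x in {x | q x < p x}ᶜ, - (p - q) x := by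
    apply setIntegral_congr_fun hA.compl
    intro x hx
    exact abs_of_nonpos (sub_nonpos.2 (not_lt.1 hx))
  rw [integral_neg] at b2
  have e5 : ∫ x, |p x - q x| = ∫ x, |(p - q) x| := rfl
  rw [e5, ← e2, b1, b2, ← e3]
  linarith

/-- Scheffe set. -/
def schSet {d N : ℕ} (f : Fin N → (Fin d → ℝ) → ℝ) (u : Fin N × Fin N) : Set (Fin d → ℝ) :=
  {x | f u.2 x < f u.1 x}

def critF {d N n : ℕ} (f : Fin N → (Fin d → ℝ) → ℝ) (θ : Fin N) (xs : Fin n → Fin d → ℝ) : ℝ :=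
  ⨆ u : Fin N × Fin N, |(∫ x in schSet f u, f θ x) - empM (schSet f u) xs|

theorem exists_sel {d N n : ℕ} (hN : 0 < N) (f : Fin N → (Fin d → ℝ) → ℝ)
    (hf : ∀ θ, MemD d (f θ)) :
    ∃ s : (Fin n → Fin d → ℝ) → Fin N, Measurable s ∧ ∀ xs θ, critF f (s xs) xs ≤ critF f θ xs := by
  have : Nonempty (Fin N) := ⟨⟨0, hN⟩⟩
  have hcm : ∀ θ, Measurable (critF (n := n) f θ) := by
    intro θ
    unfold critF
    apply Measurable.iSup
    intro u
    have hA : MeasurableSet (schSet f u) := measurableSet_lt (hf _).1 (hf _).1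
    unfold empM
    have h1 : Measurable ((schSet f u).indicator (fun _ => (1:ℝ))) := measurable_const.indicator hA
    apply Measurable.abs
    apply Measurable.const_sub
    apply Measurable.div_const
    apply Finset.measurable_fun_sum
    intro i _
    exact h1.comp (measurable_pi_apply i)
  have hex : ∀ xs : Fin n → Fin d → ℝ, ∃ m : ℕ, ∃ h : m < N, ∀ η, critF f ⟨m, h⟩ xs ≤ critF f η xs := by
    intro xs
    obtain ⟨θ, hθ⟩ := Finite.exists_min (fun θ => critF f θ xs)
    exact ⟨θ.1, θ.2, hθ⟩
  classical
  refine ⟨fun xs => ⟨Nat.find (hex xs), (Nat.find_spec (hex xs)).1⟩, ?_, ?_⟩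
  · have hmf : Measurable (fun xs => Nat.find (hex xs)) := by
      apply measurable_find
      intro m
      by_cases hm : m < N
      · have : {xs : Fin n → Fin d → ℝ | ∃ h : m < N, ∀ η, critF f ⟨m, h⟩ xs ≤ critF f η xs}
          = ⋂ η, {xs | critF f ⟨m, hm⟩ xs ≤ critF f η xs} := by
          ext xs; simp [hm]
        rw [this]
        exact MeasurableSet.iInter fun η => measurableSet_le (hcm _) (hcm _)
      · simp [hm]
    apply measurable_to_countable'
    intro θ
    have := hmf (measurableSet_singleton θ.1)
    convert this using 1
    ext xs
    simp [Fin.ext_iff]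
  · intro xs θ
    exact (Nat.find_spec (hex xs)).2 θ

theorem mde {d N n : ℕ} (hN : 0 < N) (hn : 1 ≤ n) (f : Fin N → (Fin d → ℝ) → ℝ)
    (hf : ∀ θ, MemD d (f θ)) :
    ∃ V : (Fin n → Fin d → ℝ) → (Fin d → ℝ) → ℝ,
      (∀ xs, MemD d (V xs)) ∧
      Measurable (fun z : (Fin n → Fin d → ℝ) × (Fin d → ℝ) => V z.1 z.2) ∧
      ∀ p : (Fin d → ℝ) → ℝ, MemD d p → ∀ θ : Fin N, ∀ t : ℝ, 0 ≤ t → ∀ c : ℝ,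
        3 * (∫ x, |p x - f θ x|) + 4 * t ≤ c →
        Measure.pi (fun _ : Fin n =>
            (volume : Measure (Fin d → ℝ)).withDensity fun x => ENNReal.ofReal (p x))
          {xs | c < ∫ x, |p x - V xs x| } ≤ ENNReal.ofReal (N ^ 2 * (2 * Real.exp (-2 * n * t ^ 2))) := by
  obtain ⟨s, hs, hmin⟩ := exists_sel (n := n) hN f hf
  have : Nonempty (Fin N) := ⟨⟨0, hN⟩⟩
  refine ⟨fun xs => f (s xs), fun xs => hf _, ?_, ?_⟩
  · have h : Measurable (fun z : Fin N × (Fin d → ℝ) => f z.1 z.2) :=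
      measurable_from_prod_countable_right fun θ => (hf θ).1
    exact h.comp ((hs.comp measurable_fst).prodMk measurable_snd)
  intro p hp θ t ht c hc
  set μ := (volume : Measure (Fin d → ℝ)).withDensity fun x => ENNReal.ofReal (p x) with hμ
  have hprob : IsProbabilityMeasure μ := by
    constructor
    rw [hμ, withDensity_apply _ MeasurableSet.univ, setLIntegral_univ,
      ← ofReal_integral_eq_lintegral_ofReal hp.integrable hp.2.1, hp.2.2.1]
    simp
  have hreal : ∀ A, MeasurableSet A → μ.real A = ∫ x in A, p x := by
    intro A hA
    rw [Measure.real, hμ, withDensity_apply _ hA,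
      ← ofReal_integral_eq_lintegral_ofReal hp.integrable.integrableOn (ae_restrict_of_ae hp.2.1),
      ENNReal.toReal_ofReal (integral_nonneg_of_ae (ae_restrict_of_ae hp.2.1))]
  have hA : ∀ u, MeasurableSet (schSet f u) := fun u => measurableSet_lt (hf _).1 (hf _).1
  have hsub : {xs : Fin n → Fin d → ℝ | c < ∫ x, |p x - f (s xs) x| } ⊆
      ⋃ u : Fin N × Fin N, {xs | t ≤ |empM (schSet f u) xs - μ.real (schSet f u)|} := by
    intro xs hxs
    simp only [Set.mem_ofPred_eq] at hxs
    by_contra hcon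
    simp only [Set.mem_iUnion, Set.mem_ofPred_eq, not_exists, not_le] at hcon
    have hcθ : critF f θ xs ≤ t + (∫ x, |p x - f θ x|) / 2 := by
      apply ciSup_le
      intro u
      have h1 := half_l1 hp (hf θ) _ (hA u)
      have h2 := hcon u
      rw [hreal _ (hA u)] at h2
      have h3 := abs_sub_le (∫ x in schSet f u, f θ x) (∫ x in schSet f u, p x) (empM (schSet f u) xs)
      rw [abs_sub_comm] at h1 h2
      linarith
    have hle : ∀ η u, |(∫ x in schSet f u, f η x) - empM (schSet f u) xs| ≤ critF f η xs := by
      intro η u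
      exact le_ciSup (f := fun u : Fin N × Fin N => |(∫ x in schSet f u, f η x) - empM (schSet f u) xs|)
        (Set.finite_range _).bddAbove u
    have hd1 := scheffe (hf (s xs)) (hf θ)
    have g1 := hle (s xs) (s xs, θ)
    have g2 := hle θ (s xs, θ)
    have g3 := hmin xs θ
    have hset : schSet f (s xs, θ) = {x | f θ x < f (s xs) x} := rfl
    rw [← hset] at hd1
    have g1' := (abs_le.1 g1).2
    have g2' := (abs_le.1 g2).1
    have tri : ∫ x, |p x - f (s xs) x| ≤ (∫ x, |p x - f θ x|) + ∫ x, |f (s xs) x - f θ x| := by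
      have := l1_tri hp.integrable (hf θ).integrable (hf (s xs)).integrable
      simpa only [abs_sub_comm (f θ _)] using this
    linarith
  calc _ ≤ _ := measure_mono hsub
    _ ≤ ∑ u : Fin N × Fin N, Measure.pi (fun _ : Fin n => μ) {xs | t ≤ |empM (schSet f u) xs - μ.real (schSet f u)|} :=
      measure_iUnion_fintype_le _ _
    _ ≤ ∑ u : Fin N × Fin N, ENNReal.ofReal (2 * Real.exp (-2 * n * t ^ 2)) :=
      Finset.sum_le_sum fun u _ => hoeff_two n hn μ _ (hA u) t ht
    _ = _ := by
      rw [← ENNReal.ofReal_sum_of_nonneg (fun _ _ => by positivity)]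
      congr 1
      simp
      ring

def bin (b l : ℕ) : Set ℝ := Set.Ico ((l : ℝ) / b) (((l : ℝ) + 1) / b)

def hist (b : ℕ) (a : Fin b → ℝ) (x : ℝ) : ℝ :=
  ∑ l : Fin b, a l * (bin b l).indicator (fun _ => (b : ℝ)) x

theorem bin_meas (b l : ℕ) : MeasurableSet (bin b l) := measurableSet_Ico

theorem bin_ind_integrable (b l : ℕ) (c : ℝ) : Integrable ((bin b l).indicator (fun _ => c)) := by
  rw [integrable_indicator_iff (bin_meas b l)]
  exact integrableOn_const (by simp [bin])

theorem bin_ind_integral (b l : ℕ) (hb : 1 ≤ b) :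
    ∫ x, (bin b l).indicator (fun _ => (b : ℝ)) x = 1 := by
  have hb0 : (0 : ℝ) < b := by exact_mod_cast hb
  rw [integral_indicator (bin_meas b l)]
  simp only [integral_const, smul_eq_mul, measureReal_restrict_apply_univ, bin, Real.volume_real_Ico]
  rw [max_eq_left]
  · field_simp; ring
  · rw [← sub_div, add_sub_cancel_left]; positivity

theorem hist_meas (b : ℕ) (a : Fin b → ℝ) : Measurable (hist b a) := by
  unfold hist
  apply Finset.measurable_fun_sum
  intro l _
  exact (measurable_const.indicator (bin_meas b l)).const_mul _

theorem hist_nonneg (b : ℕ) (a : Fin b → ℝ) (ha : ∀ l, 0 ≤ a l) (x : ℝ) : 0 ≤ hist b a x := by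
  apply Finset.sum_nonneg
  intro l _
  exact mul_nonneg (ha l) (Set.indicator_nonneg (fun _ _ => Nat.cast_nonneg _) _)

theorem hist_integrable (b : ℕ) (a : Fin b → ℝ) : Integrable (hist b a) := by
  unfold hist
  apply integrable_finsetSum
  intro l _
  exact (bin_ind_integrable b l _).const_mul _

theorem hist_integral (b : ℕ) (hb : 1 ≤ b) (a : Fin b → ℝ) : ∫ x, hist b a x = ∑ l, a l := by
  unfold hist
  rw [integral_finsetSum _ fun (l : Fin b) _ => (bin_ind_integrable b l _).const_mul _]
  refine Finset.sum_congr rfl fun l _ => ?_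
  rw [integral_const_mul, bin_ind_integral b l hb, mul_one]

theorem bin_sub (b : ℕ) (hb : 1 ≤ b) (l : Fin b) : bin b l ⊆ Set.Icc 0 1 := by
  have hb0 : (0 : ℝ) < b := by exact_mod_cast hb
  intro x hx
  refine ⟨le_trans (by positivity) hx.1, hx.2.le.trans ?_⟩
  rw [div_le_one hb0]
  exact_mod_cast l.2

theorem hist_supp (b : ℕ) (hb : 1 ≤ b) (a : Fin b → ℝ) (x : ℝ) (hx : x ∉ Set.Icc (0 : ℝ) 1) :
    hist b a x = 0 := by
  apply Finset.sum_eq_zero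
  intro l _
  rw [Set.indicator_of_notMem (fun h => hx (bin_sub b hb l h)), mul_zero]

theorem hist_l1 (b : ℕ) (hb : 1 ≤ b) (a a' : Fin b → ℝ) :
    ∫ x, |hist b a x - hist b a' x| ≤ ∑ l, |a l - a' l| := by
  rw [← hist_integral b hb]
  have h1 : Integrable (fun x => |hist b a x - hist b a' x|) :=
    ((hist_integrable b a).sub (hist_integrable b a')).abs
  apply integral_mono h1 (hist_integrable b _)
  intro x
  simp only [hist]
  rw [← Finset.sum_sub_distrib]
  refine (Finset.abs_sum_le_sum_abs _ _).trans (Finset.sum_le_sum fun l _ => ?_)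
  rw [← sub_mul, abs_mul, abs_of_nonneg (a := Set.indicator _ _ _) (Set.indicator_nonneg (fun _ _ => Nat.cast_nonneg _) _)]

theorem bins_sum (b r : ℕ) (x : ℝ) :
    ∑ l ∈ Finset.range r, (bin b l).indicator (fun _ => (1 : ℝ)) x
      = (Set.Ico (0 : ℝ) ((r : ℝ) / b)).indicator (fun _ => (1 : ℝ)) x := by
  induction r with
  | zero => simp
  | succ r ih =>
    rw [Finset.sum_range_succ, ih]
    have h1 : (0 : ℝ) ≤ (r : ℝ) / b := by positivity
    have h2 : (r : ℝ) / b ≤ ((r : ℝ) + 1) / b := by gcongr; linarith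
    have hu : Set.Ico (0 : ℝ) (((r + 1 : ℕ) : ℝ) / b) = Set.Ico (0 : ℝ) ((r : ℝ) / b) ∪ bin b r := by
      rw [bin, Set.Ico_union_Ico_eq_Ico h1 h2]; push_cast; rfl
    rw [hu, Set.indicator_union_of_disjoint]
    rw [bin, Set.Ico_disjoint_Ico]
    simp

theorem bins_sum_one (b : ℕ) (hb : 1 ≤ b) (x : ℝ) :
    ∑ l : Fin b, (bin b l).indicator (fun _ => (1 : ℝ)) x
      = (Set.Ico (0 : ℝ) 1).indicator (fun _ => (1 : ℝ)) x := by
  have hb0 : (b : ℝ) ≠ 0 := by positivity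
  have := bins_sum b b x
  rw [div_self hb0, Finset.sum_range] at this
  exact this

/-- Cauchy-Schwarz on a set of finite measure. -/
theorem cs_set (I : Set ℝ) (h : ℝ) (hh : 0 < h) (hI : volume.real I = h) (hfin : volume I ≠ ⊤)
    (g : ℝ → ℝ) (h1 : IntegrableOn g I) (h2 : IntegrableOn (fun x => g x ^ 2) I) :
    (∫ x in I, |g x|) ^ 2 ≤ h * ∫ x in I, g x ^ 2 := by
  set s := ∫ x in I, |g x| with hs
  have h1a : IntegrableOn (fun x => |g x|) I := h1.abs
  have hc : IntegrableOn (fun _ : ℝ => (s / h) ^ 2) I := integrableOn_const hfin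
  have h0 : 0 ≤ ∫ x in I, (|g x| - s / h) ^ 2 := integral_nonneg fun x => sq_nonneg _
  have he : ∫ x in I, (|g x| - s / h) ^ 2 = (∫ x in I, g x ^ 2) - (2 * (s / h)) * s + h * (s / h) ^ 2 := by
    have : ∀ x, (|g x| - s / h) ^ 2 = (g x ^ 2 - (2 * (s / h)) * |g x|) + (s / h) ^ 2 := by
      intro x; rw [← sq_abs (g x)]; ring
    simp_rw [this]
    have h3 : IntegrableOn (fun x => (2 * (s / h)) * |g x|) I := h1a.const_mul _
    have h4 : IntegrableOn (fun x => g x ^ 2 - (2 * (s / h)) * |g x|) I := h2.sub h3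
    rw [integral_add h4 hc, integral_sub h2 h3, integral_const_mul]
    rw [← hs]; simp [hI]
  rw [he] at h0
  have h5 : h * (2 * (s / h) * s) = 2 * s ^ 2 := by field_simp
  have h6 : h * (h * (s / h) ^ 2) = s ^ 2 := by field_simp
  nlinarith [mul_nonneg hh.le h0]

theorem bin_var (b l : ℕ) (hb : 1 ≤ b) (q : ℝ → ℝ) (L : ℝ)
    (hL : ∀ x y, |q x - q y| ≤ L * |x - y|) (hq : Continuous q) (L0 : 0 ≤ L) :
    ∫ x in bin b l, |q x - b * ∫ y in bin b l, q y| ≤ Real.sqrt 3 / 6 * L / b ^ 2 := by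
  have hb0 : (0 : ℝ) < b := by exact_mod_cast hb
  set u : ℝ := (l : ℝ) / b with hu
  set h : ℝ := 1 / b with hh
  have hpos : 0 < h := by positivity
  have hbin : bin b l = Set.Ico u (u + h) := by rw [bin, add_div]
  rw [hbin]
  set I := Set.Ico u (u + h) with hI
  have hvol : volume.real I = h := by rw [hI, Real.volume_real_Ico]; simp; linarith
  have hfin : volume I ≠ ⊤ := by simp [hI]
  have hIntg : ∀ f : ℝ → ℝ, Continuous f → IntegrableOn f I := fun f hf =>
    (hf.continuousOn.integrableOn_Icc (a := u) (b := u + h)).mono_set Set.Ico_subset_Icc_self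
  set A := ∫ y in I, q y with hA
  set c := q (u + h / 2) with hc
  have hv1 : ∫ x in I, (q x - b * A) ^ 2 ≤ ∫ x in I, (q x - c) ^ 2 := by
    have e : ∀ c : ℝ, ∫ x in I, (q x - c) ^ 2 = (∫ x in I, q x ^ 2) - (2 * c) * A + h * c ^ 2 := by
      intro c
      have : ∀ x, (q x - c) ^ 2 = (q x ^ 2 - (2 * c) * q x) + c ^ 2 := by intro x; ring
      simp_rw [this]
      rw [integral_add (hIntg _ (by fun_prop)) (integrableOn_const hfin),
        integral_sub (hIntg _ (by fun_prop)) (hIntg _ (by fun_prop)), integral_const_mul]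
      rw [← hA]; simp [hvol]
    rw [e, e]
    have hbh : (b : ℝ) = 1 / h := by rw [hh]; field_simp
    have : h * (c - A / h) ^ 2 = h * c ^ 2 - 2 * c * A + A ^ 2 / h := by field_simp; ring
    have h0 : 0 ≤ h * (c - A / h) ^ 2 := by positivity
    rw [hbh]
    have e2 : 2 * (1 / h * A) * A = 2 * (A ^ 2 / h) := by field_simp
    have e3 : h * (1 / h * A) ^ 2 = A ^ 2 / h := by field_simp
    rw [e2, e3]
    linarith
  have hv2 : ∫ x in I, (q x - c) ^ 2 ≤ ∫ x in I, L ^ 2 * (x - (u + h / 2)) ^ 2 := by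
    apply integral_mono (hIntg _ (by fun_prop)) (hIntg _ (by fun_prop))
    intro x
    have := hL x (u + h / 2)
    calc (q x - c) ^ 2 = |q x - c| ^ 2 := (sq_abs _).symm
      _ ≤ (L * |x - (u + h / 2)|) ^ 2 := by gcongr
      _ = _ := by rw [mul_pow, sq_abs]
  have hv3 : ∫ x in I, L ^ 2 * (x - (u + h / 2)) ^ 2 = L ^ 2 * h ^ 3 / 12 := by
    rw [hI, integral_Ico_eq_integral_Ioc, ← intervalIntegral.integral_of_le (by linarith),
      intervalIntegral.integral_const_mul,
      intervalIntegral.integral_comp_sub_right (fun x => x ^ 2), integral_pow]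
    norm_num
    ring
  have hcs := cs_set I h hpos hvol hfin (fun x => q x - b * A) (hIntg _ (by fun_prop)) (hIntg _ (by fun_prop))
  have hs : (∫ x in I, |q x - b * A|) ^ 2 ≤ (Real.sqrt 3 / 6 * L / b ^ 2) ^ 2 := by
    refine hcs.trans ?_
    have : (Real.sqrt 3 / 6 * L / b ^ 2) ^ 2 = h * (L ^ 2 * h ^ 3 / 12) := by
      rw [div_pow, mul_pow, div_pow, Real.sq_sqrt (by norm_num), hh]
      field_simp
      ring
    rw [this, ← hv3]
    exact mul_le_mul_of_nonneg_left (hv1.trans hv2) hpos.le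
  exact abs_le_of_sq_le_sq' hs (by positivity) |>.2

theorem hist_approx (b : ℕ) (hb : 1 ≤ b) (q : ℝ → ℝ) (hq : IsPdf1 q) (L : ℝ) (L0 : 0 ≤ L)
    (hL : ∀ x y, |q x - q y| ≤ L * |x - y|) (hs : ∀ x, x ∉ Set.Icc (0 : ℝ) 1 → q x = 0) :
    ∃ a ∈ stdSimplex ℝ (Fin b), ∫ x, |q x - hist b a x| ≤ Real.sqrt 3 / 6 * L / b := by
  have hb0 : (0 : ℝ) < b := by exact_mod_cast hb
  have hcont : Continuous q :=
    (LipschitzWith.of_dist_le_mul (K := ⟨L, L0⟩) (fun x y => hL x y)).continuous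
  have hIntg : Integrable q := by
    by_contra hc
    have := hq.2.2
    rw [integral_undef hc] at this
    norm_num at this
  have hdec : ∀ᵐ x : ℝ, q x = ∑ l : Fin b, (bin b l).indicator q x := by
    have h1 : ∀ᵐ x : ℝ, x ≠ 1 := by
      rw [ae_iff]; simp
    filter_upwards [h1] with x hx
    have e : ∀ l : Fin b, (bin b l).indicator q x = (bin b l).indicator (fun _ => (1 : ℝ)) x * q x := by
      intro l; by_cases h : x ∈ bin b l <;> simp [h]
    simp_rw [e]
    rw [← Finset.sum_mul, bins_sum_one b hb]
    by_cases h : x ∈ Set.Ico (0 : ℝ) 1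
    · simp [h]
    · rw [hs x]
      · simp
      · intro h'
        exact h ⟨h'.1, lt_of_le_of_ne h'.2 hx⟩
  refine ⟨fun l => ∫ x in bin b l, q x, ⟨fun l => ?_, ?_⟩, ?_⟩
  · exact integral_nonneg_of_ae (ae_restrict_of_ae hq.2.1)
  · rw [← hq.2.2, integral_congr_ae hdec,
      integral_finsetSum _ fun (l : Fin b) _ => hIntg.indicator (bin_meas b l)]
    exact Finset.sum_congr rfl fun l _ => (integral_indicator (bin_meas b l)).symm
  · set a : Fin b → ℝ := fun l => ∫ x in bin b l, q x with ha
    have hi2 : ∀ l : Fin b, IntegrableOn (fun x => |q x - b * a l|) (bin b l) := fun l =>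
      (hIntg.integrableOn.sub (integrableOn_const (by simp [bin]))).abs
    calc ∫ x, |q x - hist b a x|
        ≤ ∫ x, ∑ l : Fin b, (bin b l).indicator (fun x => |q x - b * a l|) x := by
          apply integral_mono_ae (hIntg.sub (hist_integrable b a)).abs
          · exact integrable_finsetSum _ fun l _ => (hi2 l).integrable_indicator (bin_meas b l)
          · filter_upwards [hdec] with x hx
            simp only [Pi.sub_apply]
            rw [hx, hist, ← Finset.sum_sub_distrib]
            refine (Finset.abs_sum_le_sum_abs _ _).trans (Finset.sum_le_sum fun l _ => ?_)
            by_cases h : x ∈ bin b l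
            · simp only [Set.indicator_of_mem h]; rw [mul_comm]
            · simp [Set.indicator_of_notMem h]
      _ = ∑ l : Fin b, ∫ x in bin b l, |q x - b * a l| := by
          rw [integral_finsetSum _ fun l _ => (hi2 l).integrable_indicator (bin_meas b l)]
          exact Finset.sum_congr rfl fun l _ => integral_indicator (bin_meas b l)
      _ ≤ ∑ l : Fin b, Real.sqrt 3 / 6 * L / b ^ 2 :=
          Finset.sum_le_sum fun l _ => bin_var b l hb q L hL hcont L0
      _ = _ := by
          simp; field_simp

theorem tensor_l1 {d : ℕ} (u v : Fin d → ℝ → ℝ) (hu : ∀ j, Integrable (u j))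
    (hv : ∀ j, Integrable (v j)) (hu1 : ∀ j, ∫ x, |u j x| ≤ 1) (hv1 : ∀ j, ∫ x, |v j x| ≤ 1) :
    ∫ x : Fin d → ℝ, |∏ j, u j (x j) - ∏ j, v j (x j)| ≤ ∑ j, ∫ x, |u j x - v j x| := by
  set T : Fin d → Fin d → ℝ → ℝ := fun i j y =>
    if j < i then v j y else if i < j then u j y else u j y - v j y with hT
  have hTi : ∀ i j, Integrable (T i j) := by
    intro i j
    simp only [hT]
    by_cases h1 : j < i
    · simpa [h1] using hv j
    · by_cases h2 : i < j
      · simpa [h1, h2] using hu j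
      · simp only [h1, h2, if_false]
        exact (hu j).sub (hv j)
  have hid : ∀ x : Fin d → ℝ, ∏ j, u j (x j) - ∏ j, v j (x j) = ∑ i, ∏ j, T i j (x j) := by
    intro x
    have h := Finset.prod_sub_ordered (Finset.univ : Finset (Fin d)) (fun j => u j (x j))
      (fun j => u j (x j) - v j (x j))
    simp only [sub_sub_cancel] at h
    rw [h, sub_sub_cancel]
    refine Finset.sum_congr rfl fun i _ => ?_
    rw [Finset.prod_filter, Finset.prod_filter]
    have : ∀ j, T i j (x j) = (if j = i then u j (x j) - v j (x j) else 1) *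
        (if j < i then v j (x j) else 1) * (if i < j then u j (x j) else 1) := by
      intro j
      simp only [hT]
      rcases lt_trichotomy j i with h | h | h
      · simp [h, h.ne, h.not_gt]
      · simp [h]
      · simp [h, h.ne', h.not_gt]
    simp_rw [this]
    rw [Finset.prod_mul_distrib, Finset.prod_mul_distrib]
    simp
  have hpi : ∀ i, Integrable (fun x : Fin d → ℝ => ∏ j, |T i j (x j)|) := fun i =>
    Integrable.fintype_prod (f := fun j y => |T i j y|) fun j => (hTi i j).abs
  have hpu : Integrable (fun x : Fin d → ℝ => ∏ j, u j (x j)) := Integrable.fintype_prod hu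
  have hpv : Integrable (fun x : Fin d → ℝ => ∏ j, v j (x j)) := Integrable.fintype_prod hv
  calc ∫ x : Fin d → ℝ, |∏ j, u j (x j) - ∏ j, v j (x j)|
      ≤ ∫ x : Fin d → ℝ, ∑ i, ∏ j, |T i j (x j)| := by
        apply integral_mono (hpu.sub hpv).abs (integrable_finsetSum _ fun i _ => hpi i)
        intro x
        simp only [Pi.sub_apply]
        rw [hid]
        refine (Finset.abs_sum_le_sum_abs _ _).trans (Finset.sum_le_sum fun i _ => ?_)
        rw [Finset.abs_prod]
    _ = ∑ i, ∏ j, ∫ y, |T i j y| := by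
        rw [integral_finsetSum _ fun i _ => hpi i]
        exact Finset.sum_congr rfl fun i _ =>
          integral_fintype_prod_volume_eq_prod (fun j y => |T i j y|)
    _ ≤ _ := by
        refine Finset.sum_le_sum fun i _ => ?_
        rw [← Finset.mul_prod_erase _ _ (Finset.mem_univ i)]
        have e : ∫ y, |T i i y| = ∫ y, |u i y - v i y| := by simp [hT]
        rw [e]
        apply mul_le_of_le_one_right (integral_nonneg fun _ => abs_nonneg _)
        apply Finset.prod_le_one (fun j _ => integral_nonneg fun _ => abs_nonneg _)
        intro j hj
        have hji := Finset.ne_of_mem_erase hj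
        simp only [hT]
        rcases lt_or_gt_of_ne hji with h | h
        · simpa [h] using hv1 j
        · simpa [h, h.not_gt] using hu1 j

theorem mix_l1 {E ι : Type*} [Fintype ι] [MeasurableSpace E] {μ : Measure E} (F G : ι → E → ℝ)
    (hF : ∀ i, Integrable (F i) μ) (hG : ∀ i, Integrable (G i) μ) (hF1 : ∀ i, ∫ x, |F i x| ∂μ ≤ 1)
    (w w' : ι → ℝ) (hw' : ∀ i, 0 ≤ w' i) :
    ∫ x, |∑ i, w i * F i x - ∑ i, w' i * G i x| ∂μ
      ≤ ∑ i, |w i - w' i| + ∑ i, w' i * ∫ x, |F i x - G i x| ∂μ := by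
  have i1 : ∀ i, Integrable (fun x => |w i - w' i| * |F i x|) μ := fun i => (hF i).abs.const_mul _
  have i2 : ∀ i, Integrable (fun x => w' i * |F i x - G i x|) μ :=
    fun i => ((hF i).sub (hG i)).abs.const_mul _
  have i3 : ∀ i, Integrable (fun x => |w i - w' i| * |F i x| + w' i * |F i x - G i x|) μ :=
    fun i => (i1 i).add (i2 i)
  calc _ ≤ ∫ x, ∑ i, (|w i - w' i| * |F i x| + w' i * |F i x - G i x|) ∂μ := by
        apply integral_mono
        · exact ((integrable_finsetSum _ fun i _ => (hF i).const_mul (w i)).sub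
            (integrable_finsetSum _ fun i _ => (hG i).const_mul (w' i))).abs
        · exact integrable_finsetSum _ fun i _ => i3 i
        intro x
        simp only
        rw [← Finset.sum_sub_distrib]
        refine (Finset.abs_sum_le_sum_abs _ _).trans (Finset.sum_le_sum fun i _ => ?_)
        have : w i * F i x - w' i * G i x = (w i - w' i) * F i x + w' i * (F i x - G i x) := by ring
        rw [this]
        refine (abs_add_le _ _).trans ?_
        rw [abs_mul, abs_mul, abs_of_nonneg (hw' i)]
    _ = ∑ i, (|w i - w' i| * ∫ x, |F i x| ∂μ) + ∑ i, w' i * ∫ x, |F i x - G i x| ∂μ := by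
        rw [integral_finsetSum _ fun i _ => i3 i, ← Finset.sum_add_distrib]
        refine Finset.sum_congr rfl fun i _ => ?_
        rw [integral_add (i1 i) (i2 i), integral_const_mul, integral_const_mul]
    _ ≤ _ := by
        gcongr with i
        exact mul_le_of_le_one_right (abs_nonneg _) (hF1 i)

def mixD {K d b : ℕ} (w : Fin K → ℝ) (h : Fin K → Fin d → Fin b → ℝ) (x : Fin d → ℝ) : ℝ :=
  ∑ i, w i * ∏ j, hist b (h i j) (x j)

theorem hist_abs {b : ℕ} (hb : 1 ≤ b) {a : Fin b → ℝ} (ha : a ∈ stdSimplex ℝ (Fin b)) :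
    ∫ x, |hist b a x| = 1 := by
  have : ∀ x, |hist b a x| = hist b a x := fun x => abs_of_nonneg (hist_nonneg b a ha.1 x)
  simp_rw [this]
  rw [hist_integral b hb, ha.2]

theorem histprod_integrable {b d : ℕ} (h : Fin d → Fin b → ℝ) :
    Integrable (fun x : Fin d → ℝ => ∏ j, hist b (h j) (x j)) :=
  Integrable.fintype_prod fun j => hist_integrable b (h j)

theorem histprod_integral {b d : ℕ} (hb : 1 ≤ b) (h : Fin d → Fin b → ℝ)
    (hh : ∀ j, h j ∈ stdSimplex ℝ (Fin b)) :
    ∫ x : Fin d → ℝ, ∏ j, hist b (h j) (x j) = 1 := by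
  rw [integral_fintype_prod_volume_eq_prod (fun j y => hist b (h j) y)]
  apply Finset.prod_eq_one
  intro j _
  rw [hist_integral b hb, (hh j).2]

theorem histprod_nonneg {b d : ℕ} (h : Fin d → Fin b → ℝ)
    (hh : ∀ j, h j ∈ stdSimplex ℝ (Fin b)) (x : Fin d → ℝ) : 0 ≤ ∏ j, hist b (h j) (x j) :=
  Finset.prod_nonneg fun j _ => hist_nonneg b _ (hh j).1 _

theorem mixD_memD {K d b : ℕ} (hb : 1 ≤ b) (w : Fin K → ℝ) (h : Fin K → Fin d → Fin b → ℝ)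
    (hw : w ∈ stdSimplex ℝ (Fin K)) (hh : ∀ i j, h i j ∈ stdSimplex ℝ (Fin b)) :
    MemD d (mixD w h) := by
  refine ⟨?_, Eventually.of_forall fun x => ?_, ?_, fun x hx => ?_⟩
  · unfold mixD
    apply Finset.measurable_fun_sum
    intro i _
    apply Measurable.const_mul
    apply Finset.measurable_fun_prod
    intro j _
    exact (hist_meas b _).comp (measurable_pi_apply j)
  · exact Finset.sum_nonneg fun i _ => mul_nonneg (hw.1 i) (histprod_nonneg _ (hh i) x)
  · unfold mixD
    rw [integral_finsetSum _ fun i _ => (histprod_integrable (h i)).const_mul _, ← hw.2]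
    refine Finset.sum_congr rfl fun i _ => ?_
    rw [integral_const_mul, histprod_integral hb _ (hh i), mul_one]
  · have : ∃ j, x j ∉ Set.Icc (0 : ℝ) 1 := by
      by_contra hc
      push Not at hc
      exact hx ⟨fun j => (hc j).1, fun j => (hc j).2⟩
    obtain ⟨j, hj⟩ := this
    apply Finset.sum_eq_zero
    intro i _
    rw [Finset.prod_eq_zero (Finset.mem_univ j) (hist_supp b hb _ _ hj), mul_zero]

def fl (m : ℕ) (x : ℝ) : Fin (m + 1) := ⟨min ⌊m * x⌋₊ m, by omega⟩

theorem fl_close {m : ℕ} (hm : 1 ≤ m) {x y : ℝ} (hx : 0 ≤ x) (hx1 : x ≤ 1) (hy : 0 ≤ y)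
    (hy1 : y ≤ 1) (h : fl m x = fl m y) : |x - y| ≤ 1 / m := by
  have hm0 : (0 : ℝ) < m := by exact_mod_cast hm
  have aux : ∀ z : ℝ, z ≤ 1 → ⌊m * z⌋₊ ≤ m := fun z hz =>
    Nat.floor_le_of_le (mul_le_of_le_one_right hm0.le hz)
  simp only [fl, Fin.mk.injEq, min_eq_left (aux x hx1), min_eq_left (aux y hy1)] at h
  have a1 := Nat.floor_le (mul_nonneg hm0.le hx)
  have a2 := Nat.lt_floor_add_one (m * x)
  have a3 := Nat.floor_le (mul_nonneg hm0.le hy)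
  have a4 := Nat.lt_floor_add_one (m * y)
  rw [h] at a1 a2
  rw [le_div_iff₀ hm0]
  have : |x - y| * m = |(x - y) * m| := by rw [abs_mul, abs_of_pos hm0]
  rw [this, abs_le]
  constructor <;> linarith

theorem simplex_le_one {n : ℕ} {a : Fin n → ℝ} (ha : a ∈ stdSimplex ℝ (Fin n)) (i : Fin n) :
    a i ≤ 1 := by
  rw [← ha.2]
  exact Finset.single_le_sum (fun j _ => ha.1 j) (Finset.mem_univ i)

theorem simplex_ne {n : ℕ} (hn : 1 ≤ n) : ∃ a : Fin n → ℝ, a ∈ stdSimplex ℝ (Fin n) := by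
  exact ⟨_, single_mem_stdSimplex ℝ (⟨0, hn⟩ : Fin n)⟩

theorem net (K d b m : ℕ) (hK : 1 ≤ K) (hb : 1 ≤ b) (hm : 1 ≤ m) :
    ∃ N : ℕ, 0 < N ∧ N = (m + 1) ^ (K + K * d * b) ∧ ∃ f : Fin N → (Fin d → ℝ) → ℝ,
      (∀ θ, MemD d (f θ)) ∧ ∀ (w : Fin K → ℝ) (h : Fin K → Fin d → Fin b → ℝ),
        w ∈ stdSimplex ℝ (Fin K) → (∀ i j, h i j ∈ stdSimplex ℝ (Fin b)) →
        ∃ θ, ∫ x, |mixD w h x - f θ x| ≤ K / m + d * b / m := by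
  let Par := {θ : (Fin K → ℝ) × (Fin K → Fin d → Fin b → ℝ) //
    θ.1 ∈ stdSimplex ℝ (Fin K) ∧ ∀ i j, θ.2 i j ∈ stdSimplex ℝ (Fin b)}
  let Code := (Fin K → Fin (m + 1)) × (Fin K → Fin d → Fin b → Fin (m + 1))
  let φ : Par → Code := fun θ => (fun i => fl m (θ.1.1 i), fun i j l => fl m (θ.1.2 i j l))
  obtain ⟨w0, hw0⟩ := simplex_ne hK
  obtain ⟨a0, ha0⟩ := simplex_ne hb
  have hne : Nonempty Par := ⟨⟨(w0, fun _ _ => a0), hw0, fun _ _ => ha0⟩⟩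
  have hcard : Fintype.card Code = (m + 1) ^ (K + K * d * b) := by
    simp only [Code, Fintype.card_prod, Fintype.card_fun, Fintype.card_fin]
    rw [← pow_mul, ← pow_mul, ← pow_add]
    congr 2
    ring
  refine ⟨Fintype.card Code, by rw [hcard]; positivity, hcard,
    fun c => mixD (Function.invFun φ ((Fintype.equivFin Code).symm c)).1.1
      (Function.invFun φ ((Fintype.equivFin Code).symm c)).1.2, fun c =>
      mixD_memD hb _ _ (Function.invFun φ _).2.1 (Function.invFun φ _).2.2, ?_⟩
  intro w h hw hh
  refine ⟨Fintype.equivFin Code (φ ⟨(w, h), hw, hh⟩), ?_⟩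
  simp only [Equiv.symm_apply_apply]
  have hφ := Function.invFun_eq (f := φ) (b := φ ⟨(w, h), hw, hh⟩) ⟨_, rfl⟩
  set θ := Function.invFun φ (φ ⟨(w, h), hw, hh⟩) with hθ
  obtain ⟨⟨w', h'⟩, hw', hh'⟩ := θ
  simp only at hw' hh' hφ ⊢
  have e1 : ∀ i, fl m (w' i) = fl m (w i) := fun i => congrFun (congrArg Prod.fst hφ) i
  have e2 : ∀ i j l, fl m (h' i j l) = fl m (h i j l) := fun i j l =>
    congrFun (congrFun (congrFun (congrArg Prod.snd hφ) i) j) l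
  have c1 : ∀ i, |w i - w' i| ≤ 1 / m := fun i =>
    fl_close hm (hw.1 i) (simplex_le_one hw i) (hw'.1 i) (simplex_le_one hw' i) (e1 i).symm
  have c2 : ∀ i j l, |h i j l - h' i j l| ≤ 1 / m := fun i j l =>
    fl_close hm ((hh i j).1 l) (simplex_le_one (hh i j) l) ((hh' i j).1 l)
      (simplex_le_one (hh' i j) l) (e2 i j l).symm
  unfold mixD
  refine (mix_l1 _ _ (fun i => histprod_integrable (h i)) (fun i => histprod_integrable (h' i))
    (fun i => ?_) w w' hw'.1).trans ?_
  · rw [← histprod_integral hb (h i) (hh i)]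
    apply le_of_eq
    refine integral_congr_ae (Eventually.of_forall fun x => ?_)
    exact abs_of_nonneg (histprod_nonneg _ (hh i) x)
  · have t : ∀ i, ∫ x : Fin d → ℝ, |∏ j, hist b (h i j) (x j) - ∏ j, hist b (h' i j) (x j)|
        ≤ d * b / m := by
      intro i
      refine (tensor_l1 (fun j => hist b (h i j)) (fun j => hist b (h' i j))
        (fun j => hist_integrable b _) (fun j => hist_integrable b _)
        (fun j => (hist_abs hb (hh i j)).le) (fun j => (hist_abs hb (hh' i j)).le)).trans ?_
      calc _ ≤ ∑ j : Fin d, ∑ l : Fin b, (1 / m : ℝ) :=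
            Finset.sum_le_sum fun j _ => (hist_l1 b hb _ _).trans
              (Finset.sum_le_sum fun l _ => c2 i j l)
        _ = _ := by simp; ring
    apply add_le_add
    · calc _ ≤ ∑ i : Fin K, (1 / m : ℝ) := Finset.sum_le_sum fun i _ => c1 i
        _ = _ := by simp; ring
    · calc _ ≤ ∑ i, w' i * (d * b / m : ℝ) :=
            Finset.sum_le_sum fun i _ => mul_le_mul_of_nonneg_left (t i) (hw'.1 i)
        _ = _ := by rw [← Finset.sum_mul, hw'.2, one_mul]

theorem pdf_int {q : ℝ → ℝ} (hq : IsPdf1 q) : Integrable q := by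
  by_contra hc
  have := hq.2.2
  rw [integral_undef hc] at this
  norm_num at this

theorem trunc {d b k : ℕ} (hb : 1 ≤ b) (W Lt : ℕ → ℝ)
    (hL0 : ∀ i, 0 ≤ Lt i) (hLmono : ∀ i, Lt i ≤ Lt (i + 1)) (p : (Fin d → ℝ) → ℝ)
    (hp : MemD d p) (hcl : MemNLClass d p W Lt) :
    ∃ (w : Fin (k + 1) → ℝ) (h : Fin (k + 1) → Fin d → Fin b → ℝ),
      w ∈ stdSimplex ℝ (Fin (k + 1)) ∧ (∀ i j, h i j ∈ stdSimplex ℝ (Fin b)) ∧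
      ∫ x, |p x - mixD w h x| ≤ 2 * W k + d * (Real.sqrt 3 / 6 * Lt k / b) := by
  obtain ⟨w, L, ⟨q, hw0, hw00, hwsum, hq, hpq⟩, hWL⟩ := hcl
  have hLi : ∀ i j x y, |q i j x - q i j y| ≤ Lt i * |x - y| := fun i j x y =>
    ((hq i j).2 x y).trans (mul_le_mul_of_nonneg_right (hWL i).1 (abs_nonneg _))
  have hmono : Monotone Lt := monotone_nat_of_le_succ hLmono
  have hqc : ∀ i j, Continuous (q i j) := fun i j =>
    (LipschitzWith.of_dist_le_mul (K := ⟨Lt i, hL0 i⟩) (fun x y => hLi i j x y)).continuous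
  have hq0 : ∀ i j x, 0 ≤ q i j x := by
    intro i j x
    have h1 : q i j =ᵐ[volume] fun x => |q i j x| := by
      filter_upwards [(hq i j).1.2.1] with x hx
      exact (abs_of_nonneg hx).symm
    have h2 := (Continuous.ae_eq_iff_eq volume (hqc i j) (hqc i j).abs).1 h1
    rw [h2]
    exact abs_nonneg _
  have hqi : ∀ i j, Integrable (q i j) := fun i j => pdf_int (hq i j).1
  have hqabs : ∀ i j, ∫ x, |q i j x| ≤ 1 := by
    intro i j
    simp_rw [abs_of_nonneg (hq0 i j _)]
    exact (hq i j).1.2.2.le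
  set F : ℕ → (Fin d → ℝ) → ℝ := fun i x => ∏ j, q i j (x j) with hF
  have hFc : ∀ i, Continuous (F i) := fun i =>
    continuous_finsetProd _ fun j _ => (hqc i j).comp (continuous_apply j)
  have hF0 : ∀ i x, 0 ≤ F i x := fun i x => Finset.prod_nonneg fun j _ => hq0 i j _
  have hFi : ∀ i, Integrable (F i) := fun i => Integrable.fintype_prod (hqi i)
  have hF1 : ∀ i, ∫ x, F i x = 1 := by
    intro i
    rw [hF, integral_fintype_prod_volume_eq_prod (fun j y => q i j y)]
    exact Finset.prod_eq_one fun j _ => (hq i j).1.2.2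
  have hFabs : ∀ i, ∫ x, |F i x| ≤ 1 := by
    intro i
    simp_rw [abs_of_nonneg (hF0 i _)]
    exact (hF1 i).le
  have hwF : ∀ i x, 0 ≤ w i * F i x := fun i x => mul_nonneg (hw0 i) (hF0 i x)
  have hsummable : ∀ᵐ x, Summable fun i => w i * F i x := by
    have hm : ∀ i, Measurable fun x => ENNReal.ofReal (w i * F i x) := fun i =>
      ((hFc i).measurable.const_mul _).ennreal_ofReal
    have h1 : ∫⁻ x, ∑' i, ENNReal.ofReal (w i * F i x) ≠ ⊤ := by
      rw [lintegral_tsum fun i => (hm i).aemeasurable]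
      have : ∀ i, ∫⁻ x, ENNReal.ofReal (w i * F i x) = ENNReal.ofReal (w i) := by
        intro i
        rw [← ofReal_integral_eq_lintegral_ofReal ((hFi i).const_mul _)
          (Eventually.of_forall (hwF i)), integral_const_mul, hF1, mul_one]
      simp_rw [this]
      exact hwsum.summable.tsum_ofReal_ne_top
    have h2 := ae_lt_top (Measurable.ennreal_tsum hm) h1
    filter_upwards [h2] with x hx
    have := ENNReal.summable_toReal hx.ne
    simpa only [ENNReal.toReal_ofReal (hwF _ x)] using this
  -- support
  have hsupp : ∀ i j, 0 < w i → ∀ t, t ∉ Set.Icc (0 : ℝ) 1 → q i j t = 0 := by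
    intro i j hwi t ht
    have hopen : IsOpen ({x | F i x ≠ 0} ∩ (Set.Icc (0 : Fin d → ℝ) 1)ᶜ) :=
      (isOpen_ne_fun (hFc i) continuous_const).inter isClosed_Icc.isOpen_compl
    have hz : volume ({x | F i x ≠ 0} ∩ (Set.Icc (0 : Fin d → ℝ) 1)ᶜ) = 0 := by
      have : ∀ᵐ x, ¬ (x ∈ {x | F i x ≠ 0} ∩ (Set.Icc (0 : Fin d → ℝ) 1)ᶜ) := by
        filter_upwards [hsummable, hpq] with x h1 h2 h3
        have h4 := hp.2.2.2 x h3.2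
        rw [h4] at h2
        have h5 : w i * F i x ≤ 0 := by
          rw [h2]
          exact h1.le_tsum i fun j _ => hwF j x
        exact h3.1 (le_antisymm (nonpos_of_mul_nonpos_right h5 hwi) (hF0 i x))
      exact measure_eq_zero_iff_ae_notMem.2 this
    have hemp := hopen.eq_empty_of_measure_zero hz
    by_contra hne
    have hex : ∀ j', ∃ y, q i j' y ≠ 0 := by
      intro j'
      by_contra hc
      push Not at hc
      have := (hq i j').1.2.2
      simp [hc] at this
    choose y hy using hex
    have hmem : Function.update y j t ∈ ({x | F i x ≠ 0} ∩ (Set.Icc (0 : Fin d → ℝ) 1)ᶜ) := by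
      constructor
      · change ∏ j', q i j' (Function.update y j t j') ≠ 0
        rw [Finset.prod_ne_zero_iff]
        intro j' _
        by_cases hj : j' = j
        · subst hj; simpa using hne
        · simpa [hj] using hy j'
      · intro hc
        apply ht
        have h1 := hc.1 j
        have h2 := hc.2 j
        simp at h1 h2
        exact ⟨h1, h2⟩
    rw [hemp] at hmem
    exact hmem
  set c : ℝ := Real.sqrt 3 / 6 * Lt k / b with hc
  have hc0 : 0 ≤ c := by have := hL0 k; positivity
  have happ : ∀ (i : Fin (k + 1)) (j : Fin d), ∃ a ∈ stdSimplex ℝ (Fin b),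
      0 < w i → ∫ x, |q i j x - hist b a x| ≤ c := by
    intro i j
    by_cases hwi : 0 < w i
    · obtain ⟨a, ha, h⟩ := hist_approx b hb (q i j) (hq i j).1 (Lt k) (hL0 k)
        (fun x y => (hLi i j x y).trans
          (mul_le_mul_of_nonneg_right (hmono (Nat.lt_succ_iff.1 i.2)) (abs_nonneg _)))
        (hsupp i j hwi)
      exact ⟨a, ha, fun _ => h⟩
    · obtain ⟨a, ha⟩ := simplex_ne hb
      exact ⟨a, ha, fun h => absurd h hwi⟩
  choose h hh hhc using happ
  set S : ℝ := ∑ i : Fin (k + 1), w i with hS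
  have hSr : S = ∑ i ∈ Finset.range (k + 1), w i := by rw [hS, Finset.sum_range]
  have hSpos : 0 < S :=
    lt_of_lt_of_le hw00 (Finset.single_le_sum (f := fun i : Fin (k + 1) => w i)
      (fun i _ => hw0 i) (Finset.mem_univ (0 : Fin (k + 1))))
  have htail : 1 - S ≤ W k := by
    have h1 := hwsum.summable.sum_add_tsum_nat_add (k + 1)
    rw [hwsum.tsum_eq, ← hSr] at h1
    have := (hWL k).2
    linarith
  have hS1 : S ≤ 1 := by
    rw [hSr]
    exact sum_le_hasSum _ (fun i _ => hw0 i) hwsum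
  have hws : (fun i : Fin (k + 1) => w i / S) ∈ stdSimplex ℝ (Fin (k + 1)) := by
    refine ⟨fun i => div_nonneg (hw0 i) hSpos.le, ?_⟩
    rw [← Finset.sum_div, ← hS, div_self hSpos.ne']
  refine ⟨fun i => w i / S, h, hws, hh, ?_⟩
  set P : (Fin d → ℝ) → ℝ := fun x => ∑ i : Fin (k + 1), w i * F i x with hP
  have hPi : Integrable P := integrable_finsetSum _ fun i _ => (hFi i).const_mul _
  have hpP : ∫ x, |p x - P x| = 1 - S := by
    have h1 : ∫ x, |p x - P x| = ∫ x, (p x - P x) := by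
      apply integral_congr_ae
      filter_upwards [hsummable, hpq] with x h1 h2
      apply abs_of_nonneg
      rw [h2, sub_nonneg, hP]
      simp only
      have := h1.sum_le_tsum (Finset.range (k + 1)) fun i _ => hwF i x
      rw [Finset.sum_range] at this
      exact this
    rw [h1, integral_sub hp.integrable hPi, hp.2.2.1, hP,
      integral_finsetSum _ fun (i : Fin (k + 1)) _ => (hFi i).const_mul _]
    simp_rw [integral_const_mul, hF1, mul_one]
    rw [hS]
  have hPg : ∫ x, |P x - mixD (fun i : Fin (k + 1) => w i / S) h x| ≤ (1 - S) + d * c := by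
    refine (mix_l1 (fun i : Fin (k + 1) => F i) _ (fun i => hFi i)
      (fun i => histprod_integrable (h i)) (fun i => hFabs i) (fun i => w i) (fun i => w i / S)
      hws.1).trans ?_
    apply add_le_add
    · have : ∀ i : Fin (k + 1), |w i - w i / S| = w i / S - w i := by
        intro i
        rw [abs_sub_comm, abs_of_nonneg]
        rw [sub_nonneg, le_div_iff₀ hSpos]
        exact mul_le_of_le_one_right (hw0 i) hS1
      simp_rw [this]
      rw [Finset.sum_sub_distrib, hws.2]
    · calc _ ≤ ∑ i : Fin (k + 1), w i / S * (d * c) := by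
            refine Finset.sum_le_sum fun i _ => ?_
            rcases (hw0 i).eq_or_lt with h0 | h0
            · simp [← h0]
            · apply mul_le_mul_of_nonneg_left _ (hws.1 i)
              refine (tensor_l1 (q i) (fun j => hist b (h i j)) (hqi i)
                (fun j => hist_integrable b _) (hqabs i)
                (fun j => (hist_abs hb (hh i j)).le)).trans ?_
              calc _ ≤ ∑ j : Fin d, c := Finset.sum_le_sum fun j _ => hhc i j h0
                _ = _ := by simp
        _ = _ := by rw [← Finset.sum_mul, hws.2, one_mul]
  have := l1_tri hp.integrable hPi (mixD_memD hb _ _ hws hh).integrable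
  linarith

set_option maxHeartbeats 2000000 in
/-- **Theorem 4.** Finite sample bound over an NL-class.  The paper's `k ∈ ℕ = {1,2,...}`
is represented as `k+1` with `k : ℕ`; by the `0`-indexing convention the paper's `L_k`
and `W_k` are `Lt k` and `W k`. -/
theorem nl_class_finite_sample_bound
    (d b k n : ℕ) (hd : 1 ≤ d) (hb : 1 ≤ b) (hn : 1 ≤ n)
    (δ : ℝ) (hδ : 0 < δ) (hδ1 : δ ≤ 1)
    (W Lt : ℕ → ℝ)
    (hW0 : ∀ i, 0 ≤ W i) (hWanti : ∀ i, W (i + 1) ≤ W i)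
    (hWlim : Tendsto W atTop (nhds 0))
    (hL0 : ∀ i, 0 ≤ Lt i) (hLmono : ∀ i, Lt i ≤ Lt (i + 1)) :
    ∃ V : (Fin n → Fin d → ℝ) → (Fin d → ℝ) → ℝ,
      (∀ xs, MemD d (V xs)) ∧
      Measurable (fun z : (Fin n → Fin d → ℝ) × (Fin d → ℝ) => V z.1 z.2) ∧
      ∀ p : (Fin d → ℝ) → ℝ,
        MemD d p → MemNLClass d p W Lt →
        Measure.pi (fun _ : Fin n =>
            (volume : Measure (Fin d → ℝ)).withDensity fun x => ENNReal.ofReal (p x))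
          {xs | Real.sqrt 3 * d / (2 * b) * Lt k
              + 6 * W k
              + 7 * Real.sqrt (2 * (b : ℝ) * d * (k + 1)
                  * Real.log (4 * (b : ℝ) * d * (k + 1) * n) / n)
              + 7 * Real.sqrt (Real.log (3 / δ) / (2 * n))
              < ∫ x, |p x - V xs x| }
          < ENNReal.ofReal δ := by
  set B : ℕ := b * d * (k + 1) with hB
  have hB1 : 1 ≤ B := Nat.mul_pos (Nat.mul_pos hb hd) (Nat.succ_pos k)
  have hBn : 1 ≤ B * n := Nat.mul_pos hB1 hn
  obtain ⟨m, hm⟩ : ∃ m : ℕ, 4 * (B * n) = m + 1 := ⟨4 * (B * n) - 1, by omega⟩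
  obtain ⟨N, hN0, hN, f, hf, hnet⟩ := net (k + 1) d b m (by omega) hb (by omega)
  obtain ⟨V, hV1, hV2, hV3⟩ := mde (n := n) hN0 hn f hf
  refine ⟨V, hV1, hV2, fun p hp hcl => ?_⟩
  obtain ⟨w, h, hw, hh, happ⟩ := trunc (k := k) hb W Lt hL0 hLmono p hp hcl
  obtain ⟨θ, hθ⟩ := hnet w h hw hh
  have hn0 : (1 : ℝ) ≤ n := by exact_mod_cast hn
  have hb0 : (1 : ℝ) ≤ b := by exact_mod_cast hb
  have hBr : (1 : ℝ) ≤ B := by exact_mod_cast hB1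
  have hBc : (B : ℝ) = b * d * (k + 1) := by rw [hB]; push_cast; ring
  have hmr : 4 * ((B : ℝ) * n) = m + 1 := by exact_mod_cast hm
  have hNr : (N : ℝ) = (4 * (B * n) : ℝ) ^ (k + 1 + (k + 1) * d * b) := by
    rw [hN, hmr]; push_cast; ring
  set lg := Real.log (4 * ((B : ℝ) * n)) with hlg
  have hBnr : (1 : ℝ) ≤ B * n := by exact_mod_cast hBn
  have hlg1 : 1 ≤ lg := by
    rw [hlg, Real.le_log_iff_exp_le (by linarith)]
    have := Real.exp_one_lt_three
    linarith
  have hQeq : 2 * (b : ℝ) * d * (k + 1) * Real.log (4 * (b : ℝ) * d * (k + 1) * n) / n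
      = 2 * B * lg / n := by
    rw [hlg, hBc]
    congr 2
    · ring
    · congr 1; ring
  have hlogN : Real.log N ≤ 2 * B * lg := by
    rw [hNr, Real.log_pow]
    apply mul_le_mul_of_nonneg_right _ (by linarith)
    have h1 : k + 1 + (k + 1) * d * b ≤ 2 * B := by
      have : k + 1 ≤ B := Nat.le_mul_of_pos_left _ (Nat.mul_pos hb hd)
      have h2 : (k + 1) * d * b = B := by rw [hB]; ring
      omega
    exact_mod_cast h1
  have hN1 : (1 : ℝ) ≤ N := by exact_mod_cast hN0
  have hlogN0 : 0 ≤ Real.log N := Real.log_nonneg hN1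
  have hld : 0 ≤ Real.log (3 / δ) := by
    apply Real.log_nonneg
    rw [le_div_iff₀ hδ]; linarith
  set Q := Real.sqrt (2 * B * lg / n) with hQ
  set R := Real.sqrt (Real.log (3 / δ) / (2 * n)) with hR
  set s := Real.sqrt (Real.log N / n) with hs
  have hsQ : s ≤ Q := by
    apply Real.sqrt_le_sqrt
    gcongr
  have hs0 : 0 ≤ s := Real.sqrt_nonneg _
  have hR0 : 0 ≤ R := Real.sqrt_nonneg _
  have hs2 : s ^ 2 = Real.log N / n := Real.sq_sqrt (by positivity)
  have hR2 : R ^ 2 = Real.log (3 / δ) / (2 * n) := Real.sq_sqrt (by positivity)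
  have hm0 : (0 : ℝ) < m := by linarith
  have heps : ((k + 1 : ℕ) : ℝ) / m + d * b / m ≤ Q := by
    have h1 : ((k + 1 : ℕ) : ℝ) ≤ B := by
      exact_mod_cast (Nat.le_mul_of_pos_left _ (Nat.mul_pos hb hd) : k + 1 ≤ B)
    have h2 : (d : ℝ) * b ≤ B := by
      have : d * b ≤ B := by
        rw [hB, mul_comm d b]; exact Nat.le_mul_of_pos_right _ (Nat.succ_pos k)
      exact_mod_cast this
    have h3 : 3 * ((B : ℝ) * n) ≤ m := by linarith
    have h4 : ((k + 1 : ℕ) : ℝ) / m + d * b / m ≤ 1 / n := by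
      rw [← add_div, div_le_div_iff₀ hm0 (by linarith), one_mul]
      have : (((k + 1 : ℕ) : ℝ) + d * b) * n ≤ (2 * B) * n := by gcongr; linarith
      linarith
    refine h4.trans (Real.le_sqrt_of_sq_le ?_)
    rw [div_pow, one_pow]
    have h5 : 1 / (n : ℝ) ^ 2 ≤ 1 / n := by
      apply one_div_le_one_div_of_le (by linarith)
      nlinarith
    have h6 : 1 / (n : ℝ) ≤ 2 * B * lg / n := by
      gcongr
      nlinarith
    exact h5.trans h6
  have htri := l1_tri hp.integrable (mixD_memD hb w h hw hh).integrable (hf θ).integrable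
  have key := hV3 p hp θ (s + R) (by positivity)
    (Real.sqrt 3 * d / (2 * b) * Lt k + 6 * W k
      + 7 * Real.sqrt (2 * (b : ℝ) * d * (k + 1)
          * Real.log (4 * (b : ℝ) * d * (k + 1) * n) / n) + 7 * R) (by
      rw [hQeq]
      have e : Real.sqrt 3 * d / (2 * b) * Lt k = 3 * (d * (Real.sqrt 3 / 6 * Lt k / b)) := by
        field_simp; ring
      rw [e]
      linarith)
  refine lt_of_le_of_lt key ?_
  rw [ENNReal.ofReal_lt_ofReal_iff hδ]
  have hexp : Real.exp (-2 * n * (s + R) ^ 2) ≤ Real.exp (-(2 * Real.log N + Real.log (3 / δ))) := by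
    apply Real.exp_le_exp.2
    have h1 : s ^ 2 + R ^ 2 ≤ (s + R) ^ 2 := by nlinarith [mul_nonneg hs0 hR0]
    have h2 : 2 * (n : ℝ) * (s ^ 2 + R ^ 2) = 2 * Real.log N + Real.log (3 / δ) := by
      rw [hs2, hR2]; field_simp
    have h3 : 2 * (n : ℝ) * (s ^ 2 + R ^ 2) ≤ 2 * n * (s + R) ^ 2 := by gcongr
    linarith
  have hval : Real.exp (-(2 * Real.log N + Real.log (3 / δ))) = δ / (3 * N ^ 2) := by
    rw [Real.exp_neg, Real.exp_add, Real.exp_log (by positivity), two_mul, Real.exp_add,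
      Real.exp_log (by linarith)]
    field_simp
  rw [hval] at hexp
  calc (N : ℝ) ^ 2 * (2 * Real.exp (-2 * n * (s + R) ^ 2))
      ≤ (N : ℝ) ^ 2 * (2 * (δ / (3 * N ^ 2))) := by gcongr
    _ = 2 / 3 * δ := by field_simp
    _ < δ := by linarith
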